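/- Let M be a finite signed measure concentrated on ℤ^k, and for each j = 1,...,k let ψ_j be either the function t ↦ e^{−t²/2} or the function t ↦ t e^{−t²/2}. For a ∈ ℝ^k and β_1,...,β_k ≥ 1, set t_β = (t_1/β_1, ..., t_k/β_k) and V(a,β) = ∫_{ℝ^k} ∏_{m=1}^k ψ_m(t_m) · e^{−i(t_β, a)} · M̂(t_β) dt_1 ⋯ dt_k. Then: (i) ‖M‖_∞ ≥ (4√(2π))^{−k} (∏_{j=1}^k β_j^{−1}) |V(a,β)|; (ii) ‖M‖_1 ≥ (√(2π))^{−k} |V(a,β)|; and (iii) for every α > 1, ‖M‖_α ≥ (√(2π))^{−k} · 5^{−k(α−1)/α} · (∏_{j=1}^k β_j^{−(α−1)/α}) · |V(a,β)|. -/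

import Mathlib

open MeasureTheory ProbabilityTheory Filter

noncomputable section

namespace CV

/-- The `r`-th standard coordinate vector of `ℤ^k`. -/
def e (k : ℕ) (r : Fin k) : Fin k → ℤ := fun j => if j = r then 1 else 0

/-- Local (sup) norm of a finite signed measure on `ℤ^k`, given via its point masses. -/
def normInf {k : ℕ} (f : (Fin k → ℤ) → ℝ) : ℝ := ⨆ m : Fin k → ℤ, |f m|

/-- The `ℓ_α` norm of a finite signed measure on `ℤ^k`, given via its point masses. -/
def normL {k : ℕ} (α : ℝ) (f : (Fin k → ℤ) → ℝ) : ℝ :=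
  (∑' m : Fin k → ℤ, |f m| ^ α) ^ (1 / α)

/-- One-dimensional Poisson pmf `P(λ,s)`, extended by `0` to negative integers. -/
def poisP (lam : ℝ) (s : ℤ) : ℝ :=
  if 0 ≤ s then Real.exp (-lam) * lam ^ s.toNat / (Nat.factorial s.toNat) else 0

/-- `ΔP(λ,s) = P(λ,s) − P(λ,s−1)`. -/
def dP (lam : ℝ) (s : ℤ) : ℝ := poisP lam s - poisP lam (s - 1)

/-- `Δ²P(λ,s) = ΔP(λ,s) − ΔP(λ,s−1)`. -/
def d2P (lam : ℝ) (s : ℤ) : ℝ := dP lam s - dP lam (s - 1)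

/-- `k`-dimensional Poisson pmf with independent coordinates. -/
def pois {k : ℕ} (lam : Fin k → ℝ) (m : Fin k → ℤ) : ℝ := ∏ j, poisP (lam j) (m j)

/-- Point masses of the distribution of a `ℤ^k`-valued random vector `S`. -/
def dist {k : ℕ} {Ω : Type*} [MeasurableSpace Ω] (μ : Measure Ω)
    (S : Ω → (Fin k → ℤ)) (m : Fin k → ℤ) : ℝ := (μ {ω | S ω = m}).toReal

/-- Fourier transform (characteristic function) of a finite signed measure on `ℤ^k`. -/
def ft {k : ℕ} (f : (Fin k → ℤ) → ℝ) (t : Fin k → ℝ) : ℂ :=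
  ∑' m : Fin k → ℤ, (f m : ℂ) * Complex.exp (Complex.I * ∑ j, (m j : ℂ) * (t j : ℂ))

/-- 1-dependence of a sequence of random vectors: for every `t`, the σ-algebras generated by
`X_0, …, X_{t-1}` and by `X_{t+1}, X_{t+2}, …` are independent. -/
def OneDependent {Ω : Type*} [MeasurableSpace Ω] {k : ℕ}
    (μ : Measure Ω) (X : ℕ → Ω → (Fin k → ℤ)) : Prop :=
  ∀ t : ℕ, Indep
    (⨆ i : ℕ, ⨆ _ : i < t, MeasurableSpace.comap (X i) inferInstance)
    (⨆ i : ℕ, ⨆ _ : t + 1 ≤ i, MeasurableSpace.comap (X i) inferInstance) μ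

/-- Fourier transform of the signed compound Poisson measure `G`. -/
def Ghat {k : ℕ} (n : ℕ) (p : Fin k → ℝ) (p2 : Fin k → Fin k → ℝ) (t : Fin k → ℝ) : ℂ :=
  Complex.exp ((n : ℂ) * ∑ j, (p j : ℂ) * (Complex.exp (Complex.I * t j) - 1)
    - (n : ℂ) / 2 * (∑ j, (p j : ℂ) * (Complex.exp (Complex.I * t j) - 1)) ^ 2
    + ((n : ℂ) - 1) * ∑ j, ∑ m, ((p2 j m : ℂ) - (p j : ℂ) * (p m : ℂ)) *
        (Complex.exp (Complex.I * t j) - 1) * (Complex.exp (Complex.I * t m) - 1))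

/-- The first-order correction signed measure `A₁`. -/
def A1 {k : ℕ} (n : ℕ) (p : Fin k → ℝ) (p2 : Fin k → Fin k → ℝ) (m : Fin k → ℤ) : ℝ :=
  (∑ j, (((n : ℝ) - 1) * (p2 j j - p j * p j) - (n : ℝ) / 2 * p j * p j) *
      d2P (n * p j) (m j) * ∏ l ∈ Finset.univ.erase j, poisP (n * p l) (m l)) +
  ∑ j, ∑ r ∈ Finset.univ.erase j,
    (((n : ℝ) - 1) * (p2 j r - p j * p r) - (n : ℝ) / 2 * p j * p r) *
      dP (n * p j) (m j) * dP (n * p r) (m r) *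
      ∏ l ∈ (Finset.univ.erase j).erase r, poisP (n * p l) (m l)

end CV

namespace CV

/-- A shifted Gaussian at the centre of a unit interval is at most `exp (b / 4)` times its mean. -/
lemma exp_mul_exp_le_intervalIntegral {b : ℝ} (hb : 0 ≤ b) (a c : ℝ) :
    Real.exp (-b / 4) * Real.exp (-b * (c - a) ^ 2) ≤
      ∫ x in (c - 1 / 2)..(c + 1 / 2), Real.exp (-b * (x - a) ^ 2) := by
  set K : ℝ := Real.exp (-b / 4) * Real.exp (-b * (c - a) ^ 2) with hK
  have hlin : ∫ x in (c - 1 / 2)..(c + 1 / 2), K * (1 - 2 * b * (c - a) * (x - c)) = K := by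
    have hsub : ∫ x in (c - 1 / 2)..(c + 1 / 2), (x - c) = 0 := by
      rw [intervalIntegral.integral_comp_sub_right (fun x => x) c, integral_id]
      ring
    rw [intervalIntegral.integral_const_mul, intervalIntegral.integral_sub (by simp)
      (Continuous.intervalIntegrable (by fun_prop) _ _), intervalIntegral.integral_const_mul, hsub]
    simp
    norm_num
  rw [← hlin]
  refine intervalIntegral.integral_mono_on (by linarith)
    (Continuous.intervalIntegrable (by fun_prop) _ _)
    (Continuous.intervalIntegrable (by fun_prop) _ _) fun x hx => ?_
  have hu : (x - c) ^ 2 ≤ 1 / 4 := by nlinarith [hx.1, hx.2]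
  calc K * (1 - 2 * b * (c - a) * (x - c))
      ≤ K * Real.exp (-(2 * b * (c - a) * (x - c))) := by
        refine mul_le_mul_of_nonneg_left ?_ (by positivity)
        linarith [Real.add_one_le_exp (-(2 * b * (c - a) * (x - c)))]
    _ ≤ Real.exp (-b * (x - a) ^ 2) := by
        rw [hK, ← Real.exp_add, ← Real.exp_add]
        refine Real.exp_le_exp.2 ?_
        nlinarith [mul_le_mul_of_nonneg_left hu hb]

lemma summable_and_tsum_exp_neg_sq_div_four_le (a : ℝ) {β : ℝ} (hβ : 1 ≤ β) :
    (Summable fun n : ℤ => Real.exp (-(((n : ℝ) - a) / β) ^ 2 / 4)) ∧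
      ∑' n : ℤ, Real.exp (-(((n : ℝ) - a) / β) ^ 2 / 4) ≤ 4 * β := by
  have hβ0 : 0 < β := by linarith
  set b : ℝ := 1 / (4 * β ^ 2) with hb
  have hb0 : 0 < b := by positivity
  have hb4 : b ≤ 1 / 4 := by
    rw [hb]
    exact one_div_le_one_div_of_le (by norm_num) (by nlinarith)
  have hint : Integrable fun x : ℝ => Real.exp (-b * (x - a) ^ 2) :=
    (integrable_exp_neg_mul_sq hb0).comp_sub_right a
  have hsum := hint.hasSum_intervalIntegral (-1 / 2)
  have hval : ∫ x : ℝ, Real.exp (-b * (x - a) ^ 2) ≤ 71 / 20 * β := by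
    rw [integral_sub_right_eq_self (fun x : ℝ => Real.exp (-b * x ^ 2)) a, integral_gaussian]
    refine Real.sqrt_le_iff.2 ⟨by positivity, ?_⟩
    have : Real.pi / b = 4 * Real.pi * β ^ 2 := by
      rw [hb]; field_simp
    rw [this]
    nlinarith [Real.pi_lt_d2, sq_nonneg β]
  have hterm (n : ℤ) : Real.exp (-(((n : ℝ) - a) / β) ^ 2 / 4) ≤
      16 / 15 * ∫ x in (-1 / 2 + (n : ℝ))..(-1 / 2 + (n : ℝ) + 1), Real.exp (-b * (x - a) ^ 2) := by
    have h := exp_mul_exp_le_intervalIntegral hb0.le a n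
    have e1 : (-1 / 2 + (n : ℝ)) = n - 1 / 2 := by ring
    have e2 : ((n : ℝ) - 1 / 2 + 1) = n + 1 / 2 := by ring
    have e3 : -(((n : ℝ) - a) / β) ^ 2 / 4 = -b * (n - a) ^ 2 := by
      rw [hb]; field_simp
    rw [e1, e2, e3]
    have h15 : (15 / 16 : ℝ) ≤ Real.exp (-b / 4) := by
      linarith [Real.add_one_le_exp (-b / 4)]
    nlinarith [Real.exp_pos (-b * ((n : ℝ) - a) ^ 2)]
  have hs : Summable fun n : ℤ => Real.exp (-(((n : ℝ) - a) / β) ^ 2 / 4) :=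
    Summable.of_nonneg_of_le (fun _ => (Real.exp_pos _).le) hterm (hsum.summable.mul_left _)
  refine ⟨hs, ?_⟩
  have h := hs.tsum_le_tsum hterm (hsum.summable.mul_left _)
  rw [tsum_mul_left, hsum.tsum_eq] at h
  linarith

lemma integrable_exp_neg_sq_div_two : Integrable fun t : ℝ => Real.exp (-t ^ 2 / 2) := by
  refine (integrable_exp_neg_mul_sq (b := 1 / 2) (by norm_num)).congr (.of_forall fun t => ?_)
  dsimp only
  ring_nf

lemma integrable_mul_exp_neg_sq_div_two : Integrable fun t : ℝ => t * Real.exp (-t ^ 2 / 2) := by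
  refine (integrable_mul_exp_neg_mul_sq (b := 1 / 2) (by norm_num)).congr (.of_forall fun t => ?_)
  dsimp only
  ring_nf

lemma integrable_mul_cexp_I {f : ℝ → ℝ} (hf : Integrable f) (x : ℝ) :
    Integrable fun t : ℝ => (f t : ℂ) * Complex.exp (Complex.I * (t * x : ℝ)) := by
  refine hf.ofReal.mul_bdd (c := 1) (by fun_prop) (.of_forall fun t => ?_)
  rw [mul_comm, Complex.norm_exp_ofReal_mul_I]

lemma integral_exp_neg_sq_div_two_mul_cexp_I (x : ℝ) :
    ∫ t : ℝ, (Real.exp (-t ^ 2 / 2) : ℂ) * Complex.exp (Complex.I * (t * x : ℝ)) =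
      (Real.sqrt (2 * Real.pi) * Real.exp (-x ^ 2 / 2) : ℝ) := by
  have h := fourierIntegral_gaussian (b := 1 / 2) (by norm_num) (x : ℂ)
  have hpi : ((Real.pi : ℂ) / (1 / 2)) ^ (1 / 2 : ℂ) = (Real.sqrt (2 * Real.pi) : ℝ) := by
    rw [Real.sqrt_eq_rpow, Complex.ofReal_cpow (by positivity)]
    push_cast
    congr 1
    ring
  rw [hpi] at h
  rw [Complex.ofReal_mul, Complex.ofReal_exp]
  convert h using 2
  · funext t
    rw [mul_comm]
    push_cast
    congr 2 <;> ring
  · push_cast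
    congr 1
    ring

lemma integral_mul_exp_neg_sq_div_two_mul_cexp_I (x : ℝ) :
    ∫ t : ℝ, ((t * Real.exp (-t ^ 2 / 2) : ℝ) : ℂ) * Complex.exp (Complex.I * (t * x : ℝ)) =
      Complex.I * x * (Real.sqrt (2 * Real.pi) * Real.exp (-x ^ 2 / 2) : ℝ) := by
  have h0 := integrable_mul_cexp_I integrable_exp_neg_sq_div_two x
  have h1 := integrable_mul_cexp_I integrable_mul_exp_neg_sq_div_two x
  have hderiv (t : ℝ) : HasDerivAt
      (fun t : ℝ => (Real.exp (-t ^ 2 / 2) : ℂ) * Complex.exp (Complex.I * (t * x : ℝ)))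
      (Complex.I * x * ((Real.exp (-t ^ 2 / 2) : ℂ) * Complex.exp (Complex.I * (t * x : ℝ))) -
        ((t * Real.exp (-t ^ 2 / 2) : ℝ) : ℂ) * Complex.exp (Complex.I * (t * x : ℝ))) t := by
    have hr : HasDerivAt (fun t : ℝ => Real.exp (-t ^ 2 / 2))
        (Real.exp (-t ^ 2 / 2) * (-(2 * t) / 2)) t := by
      simpa using (((hasDerivAt_pow 2 t).neg.div_const 2).exp)
    have hc : HasDerivAt (fun t : ℝ => Complex.exp (Complex.I * (t * x : ℝ)))
        (Complex.exp (Complex.I * (t * x : ℝ)) * (Complex.I * (1 * x : ℝ))) t :=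
      ((((hasDerivAt_id t).mul_const x).ofReal_comp).const_mul Complex.I).cexp
    refine (hr.ofReal_comp.mul hc).congr_deriv ?_
    push_cast
    ring
  have hz := integral_eq_zero_of_hasDerivAt_of_integrable hderiv ((h0.const_mul _).sub h1) h0
  rw [integral_sub (h0.const_mul _) h1, integral_const_mul,
    integral_exp_neg_sq_div_two_mul_cexp_I, sub_eq_zero] at hz
  exact hz.symm

lemma integrable_and_norm_integral_le {ψ : ℝ → ℝ}
    (hψ : ψ = (fun t => Real.exp (-t ^ 2 / 2)) ∨ ψ = (fun t => t * Real.exp (-t ^ 2 / 2))) :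
    Integrable ψ ∧ ∀ x : ℝ, ‖∫ t : ℝ, (ψ t : ℂ) * Complex.exp (Complex.I * (t * x : ℝ))‖ ≤
      Real.sqrt (2 * Real.pi) * Real.exp (-x ^ 2 / 4) := by
  rcases hψ with rfl | rfl
  · refine ⟨integrable_exp_neg_sq_div_two, fun x => ?_⟩
    rw [integral_exp_neg_sq_div_two_mul_cexp_I, Complex.norm_of_nonneg (by positivity)]
    gcongr ?_ * Real.exp ?_
    nlinarith [sq_nonneg x]
  · refine ⟨integrable_mul_exp_neg_sq_div_two, fun x => ?_⟩
    rw [integral_mul_exp_neg_sq_div_two_mul_cexp_I, norm_mul,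
      Complex.norm_of_nonneg (by positivity), norm_mul, Complex.norm_I, one_mul,
      Complex.norm_real, Real.norm_eq_abs]
    have hx : |x| ≤ Real.exp (x ^ 2 / 4) := by
      nlinarith [Real.add_one_le_exp (x ^ 2 / 4), sq_nonneg (1 - |x| / 2), sq_abs x]
    calc |x| * (Real.sqrt (2 * Real.pi) * Real.exp (-x ^ 2 / 2))
        ≤ Real.exp (x ^ 2 / 4) * (Real.sqrt (2 * Real.pi) * Real.exp (-x ^ 2 / 2)) := by gcongr
      _ = Real.sqrt (2 * Real.pi) * (Real.exp (x ^ 2 / 4) * Real.exp (-x ^ 2 / 2)) := by ring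
      _ = Real.sqrt (2 * Real.pi) * Real.exp (-x ^ 2 / 4) := by
        rw [← Real.exp_add]
        ring_nf

lemma summable_and_tsum_prod_le {k : ℕ} {ι : Type*} {g : Fin k → ι → ℝ} {c : Fin k → ℝ}
    (hg : ∀ j n, 0 ≤ g j n) (hs : ∀ j, Summable (g j)) (hc : ∀ j, ∑' n, g j n ≤ c j) :
    (Summable fun m : Fin k → ι => ∏ j, g j (m j)) ∧
      ∑' m : Fin k → ι, ∏ j, g j (m j) ≤ ∏ j, c j := by
  have := Classical.decEq ι
  have hnn : 0 ≤ fun m : Fin k → ι => ∏ j, g j (m j) :=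
    fun m => Finset.prod_nonneg fun j _ => hg j _
  have hbound (u : Finset (Fin k → ι)) : ∑ m ∈ u, ∏ j, g j (m j) ≤ ∏ j, c j := by
    set s : Fin k → Finset ι := fun j => u.image fun m => m j
    calc ∑ m ∈ u, ∏ j, g j (m j)
        ≤ ∑ m ∈ Fintype.piFinset s, ∏ j, g j (m j) := by
          refine Finset.sum_le_sum_of_subset_of_nonneg (fun m hm => ?_) fun m _ _ => hnn m
          exact Fintype.mem_piFinset.2 fun j => Finset.mem_image_of_mem _ hm
      _ = ∏ j, ∑ n ∈ s j, g j n := (Finset.prod_univ_sum s g).symm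
      _ ≤ ∏ j, c j := Finset.prod_le_prod (fun j _ => Finset.sum_nonneg fun n _ => hg j n)
          fun j _ => ((hs j).sum_le_tsum _ fun n _ => hg j n).trans (hc j)
  exact ⟨summable_of_sum_le hnn hbound, Real.tsum_le_of_sum_le hnn hbound⟩

lemma summable_abs_rpow {ι : Type*} {f : ι → ℝ} (hf : Summable fun i => |f i|) {α : ℝ}
    (hα : 1 ≤ α) : Summable fun i => |f i| ^ α := by
  refine Summable.of_nonneg_of_le (fun i => by positivity) (fun i => ?_)
    (hf.mul_right ((∑' i, |f i|) ^ (α - 1)))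
  rcases (abs_nonneg (f i)).eq_or_lt with h | h
  · rw [← h, Real.zero_rpow (by linarith), zero_mul]
  · calc |f i| ^ α = |f i| ^ (1 + (α - 1)) := by ring_nf
      _ = |f i| * |f i| ^ (α - 1) := by rw [Real.rpow_add h, Real.rpow_one]
      _ ≤ _ := mul_le_mul_of_nonneg_left (Real.rpow_le_rpow h.le
          (hf.le_tsum i fun j _ => abs_nonneg _) (by linarith)) h.le

/-- Termwise integration of the inversion integral gives a Gaussian-weighted bound. -/
lemma norm_integral_prod_mul_ft_le {k : ℕ} {M : (Fin k → ℤ) → ℝ}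
    (hM : Summable fun m => |M m|) {ψ : Fin k → ℝ → ℝ}
    (hψ : ∀ j, ψ j = (fun t => Real.exp (-t ^ 2 / 2)) ∨
      ψ j = (fun t => t * Real.exp (-t ^ 2 / 2)))
    (a β : Fin k → ℝ) :
    ‖∫ t : Fin k → ℝ, ((∏ m, ψ m (t m) : ℝ) : ℂ) *
      (Complex.exp (-Complex.I * ∑ j, ((t j / β j : ℝ) : ℂ) * (a j : ℂ)) *
        ft M (fun j => t j / β j))‖ ≤
      Real.sqrt (2 * Real.pi) ^ k *
        ∑' m, |M m| * ∏ j, Real.exp (-(((m j : ℝ) - a j) / β j) ^ 2 / 4) := by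
  set F : (Fin k → ℤ) → (Fin k → ℝ) → ℂ := fun m t => (M m : ℂ) *
    ∏ j, ((ψ j (t j) : ℂ) * Complex.exp (Complex.I * (t j * ((m j - a j) / β j) : ℝ))) with hF
  have hpt (t : Fin k → ℝ) : ((∏ m, ψ m (t m) : ℝ) : ℂ) *
      (Complex.exp (-Complex.I * ∑ j, ((t j / β j : ℝ) : ℂ) * (a j : ℂ)) *
        ft M (fun j => t j / β j)) = ∑' m, F m t := by
    rw [ft, ← tsum_mul_left, ← tsum_mul_left]
    refine tsum_congr fun m => ?_
    simp only [hF]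
    rw [Finset.prod_mul_distrib, ← Complex.exp_sum, ← Finset.mul_sum, Complex.ofReal_prod]
    have hexp : Complex.exp (Complex.I * ∑ j, ((t j * ((m j - a j) / β j) : ℝ) : ℂ)) =
        Complex.exp (-Complex.I * ∑ j, ((t j / β j : ℝ) : ℂ) * (a j : ℂ)) *
          Complex.exp (Complex.I * ∑ j, (m j : ℂ) * ((t j / β j : ℝ) : ℂ)) := by
      rw [← Complex.exp_add, neg_mul, neg_add_eq_sub, ← mul_sub, ← Finset.sum_sub_distrib]
      congr 2
      refine Finset.sum_congr rfl fun j _ => ?_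
      push_cast
      ring
    rw [hexp]
    ring
  have hint (m : Fin k → ℤ) : Integrable (F m) :=
    (Integrable.fintype_prod fun j =>
      integrable_mul_cexp_I (integrable_and_norm_integral_le (hψ j)).1 _).const_mul _
  have hnorm (m : Fin k → ℤ) :
      ∫ t, ‖F m t‖ = |M m| * ∫ t : Fin k → ℝ, ∏ j, |ψ j (t j)| := by
    rw [← integral_const_mul]
    refine integral_congr_ae (.of_forall fun t => ?_)
    simp only [hF, norm_mul, norm_prod, Complex.norm_real, Real.norm_eq_abs]
    congr 1
    refine Finset.prod_congr rfl fun j _ => ?_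
    rw [mul_comm Complex.I, Complex.norm_exp_ofReal_mul_I, mul_one]
  have hsum := hasSum_integral_of_summable_integral_norm hint
    (by simpa only [hnorm] using hM.mul_right _)
  have hle (m : Fin k → ℤ) : ‖∫ t, F m t‖ ≤ Real.sqrt (2 * Real.pi) ^ k *
      (|M m| * ∏ j, Real.exp (-(((m j : ℝ) - a j) / β j) ^ 2 / 4)) := by
    simp only [hF]
    rw [integral_const_mul, integral_fintype_prod_volume_eq_prod
      (fun j (s : ℝ) => (ψ j s : ℂ) * Complex.exp (Complex.I * (s * ((m j - a j) / β j) : ℝ))),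
      norm_mul, Complex.norm_real, Real.norm_eq_abs, norm_prod, mul_left_comm]
    refine mul_le_mul_of_nonneg_left ?_ (abs_nonneg _)
    calc _ ≤ ∏ j, (Real.sqrt (2 * Real.pi) * Real.exp (-(((m j : ℝ) - a j) / β j) ^ 2 / 4)) :=
          Finset.prod_le_prod (fun _ _ => norm_nonneg _)
            fun j _ => (integrable_and_norm_integral_le (hψ j)).2 _
      _ = _ := by rw [Finset.prod_mul_distrib]; simp
  have hw : Summable fun m : Fin k → ℤ =>
      |M m| * ∏ j, Real.exp (-(((m j : ℝ) - a j) / β j) ^ 2 / 4) := by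
    refine Summable.of_nonneg_of_le (fun m => by positivity) (fun m => ?_) hM
    refine mul_le_of_le_one_right (abs_nonneg _) (Finset.prod_le_one (fun _ _ => by positivity) ?_)
    exact fun j _ => Real.exp_le_one_iff.2 (by nlinarith [sq_nonneg (((m j : ℝ) - a j) / β j)])
  simp only [hpt]
  rw [← hsum.tsum_eq, ← tsum_mul_left]
  exact tsum_of_norm_bounded (hw.mul_left _).hasSum hle

end CV

theorem lower_bound_inversion (k : ℕ) (M : (Fin k → ℤ) → ℝ)
    (hM : Summable fun m => |M m|)
    (ψ : Fin k → ℝ → ℝ)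
    (hψ : ∀ j, ψ j = (fun t => Real.exp (-t ^ 2 / 2)) ∨
      ψ j = (fun t => t * Real.exp (-t ^ 2 / 2)))
    (a : Fin k → ℝ) (β : Fin k → ℝ) (hβ : ∀ j, 1 ≤ β j) :
    ∀ V : ℂ, V = (∫ t : Fin k → ℝ,
        ((∏ m, ψ m (t m) : ℝ) : ℂ) *
          (Complex.exp (-Complex.I * ∑ j, ((t j / β j : ℝ) : ℂ) * (a j : ℂ)) *
            CV.ft M (fun j => t j / β j))) →
      (((4 * Real.sqrt (2 * Real.pi)) ^ k)⁻¹ * (∏ j, (β j)⁻¹) * ‖V‖ ≤ CV.normInf M) ∧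
      ((Real.sqrt (2 * Real.pi) ^ k)⁻¹ * ‖V‖ ≤ CV.normL 1 M) ∧
      (∀ α : ℝ, 1 < α →
        (Real.sqrt (2 * Real.pi) ^ k)⁻¹ * (5 : ℝ) ^ (-((k : ℝ) * (α - 1) / α)) *
            (∏ j, (β j) ^ (-((α - 1) / α))) * ‖V‖ ≤ CV.normL α M) := by
  rintro V rfl
  set w : (Fin k → ℤ) → ℝ := fun m => ∏ j, Real.exp (-(((m j : ℝ) - a j) / β j) ^ 2 / 4)
  have hV := CV.norm_integral_prod_mul_ft_le hM hψ a β
  set V : ℂ := ∫ t : Fin k → ℝ, ((∏ m, ψ m (t m) : ℝ) : ℂ) *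
    (Complex.exp (-Complex.I * ∑ j, ((t j / β j : ℝ) : ℂ) * (a j : ℂ)) *
      CV.ft M (fun j => t j / β j))
  have hβ0 (j : Fin k) : 0 < β j := by linarith [hβ j]
  have hw0 (m : Fin k → ℤ) : 0 ≤ w m := by positivity
  have hw1 (m : Fin k → ℤ) : w m ≤ 1 := Finset.prod_le_one (fun _ _ => by positivity)
    fun j _ => Real.exp_le_one_iff.2 (by nlinarith [sq_nonneg (((m j : ℝ) - a j) / β j)])
  obtain ⟨hws, hwle⟩ := CV.summable_and_tsum_prod_le
    (g := fun j (n : ℤ) => Real.exp (-(((n : ℝ) - a j) / β j) ^ 2 / 4)) (c := fun j => 4 * β j)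
    (fun _ _ => by positivity)
    (fun j => (CV.summable_and_tsum_exp_neg_sq_div_four_le (a j) (hβ j)).1)
    (fun j => (CV.summable_and_tsum_exp_neg_sq_div_four_le (a j) (hβ j)).2)
  change Summable w at hws
  change ∑' m, w m ≤ _ at hwle
  rw [Finset.prod_mul_distrib, Finset.prod_const, Finset.card_univ, Fintype.card_fin] at hwle
  have hMw : Summable fun m => |M m| * w m :=
    Summable.of_nonneg_of_le (fun m => mul_nonneg (abs_nonneg _) (hw0 m))
      (fun m => mul_le_of_le_one_right (abs_nonneg _) (hw1 m)) hM
  set C : ℝ := Real.sqrt (2 * Real.pi)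
  have hC0 : 0 < C := Real.sqrt_pos.2 (by positivity)
  have hP0 : 0 < ∏ j, β j := Finset.prod_pos fun j _ => hβ0 j
  refine ⟨?_, ?_, fun α hα => ?_⟩
  · have hbdd : BddAbove (Set.range fun m => |M m|) :=
      ⟨∑' m, |M m|, by rintro _ ⟨m, rfl⟩; exact hM.le_tsum m fun _ _ => abs_nonneg _⟩
    have hN0 : 0 ≤ CV.normInf M := Real.iSup_nonneg fun _ => abs_nonneg _
    have hle : ∑' m, |M m| * w m ≤ CV.normInf M * (4 ^ k * ∏ j, β j) := by
      calc ∑' m, |M m| * w m ≤ ∑' m, CV.normInf M * w m :=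
            hMw.tsum_le_tsum (fun m => mul_le_mul_of_nonneg_right (le_ciSup hbdd m) (hw0 m))
              (hws.mul_left _)
        _ = CV.normInf M * ∑' m, w m := tsum_mul_left
        _ ≤ _ := mul_le_mul_of_nonneg_left hwle hN0
    rw [Finset.prod_inv_distrib, ← mul_inv, inv_mul_le_iff₀ (by positivity), mul_pow]
    calc ‖V‖ ≤ C ^ k * (CV.normInf M * (4 ^ k * ∏ j, β j)) := hV.trans (by gcongr)
      _ = _ := by ring
  · have hN : CV.normL 1 M = ∑' m, |M m| := by simp [CV.normL]
    rw [hN, inv_mul_le_iff₀ (by positivity)]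
    refine hV.trans (mul_le_mul_of_nonneg_left ?_ (by positivity))
    exact hMw.tsum_le_tsum (fun m => mul_le_of_le_one_right (abs_nonneg _) (hw1 m)) hM
  · have hα0 : 0 < α := by linarith
    have hconj := Real.HolderConjugate.conjExponent hα
    set q : ℝ := Real.conjExponent α with hq
    have hq1 : 1 ≤ q := hconj.symm.lt.le
    have hqinv : 1 / q = (α - 1) / α := by
      rw [hq, Real.conjExponent, one_div_div]
    have hwq (m : Fin k → ℤ) : w m ^ q ≤ w m := by
      simpa using Real.rpow_le_rpow_of_exponent_ge' (hw0 m) (hw1 m) zero_le_one hq1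
    have hwqs : Summable fun m => w m ^ q :=
      Summable.of_nonneg_of_le (fun m => Real.rpow_nonneg (hw0 m) _) hwq hws
    have hle5 : ∑' m, w m ^ q ≤ 5 ^ k * ∏ j, β j := by
      calc ∑' m, w m ^ q ≤ ∑' m, w m := hwqs.tsum_le_tsum hwq hws
        _ ≤ 4 ^ k * ∏ j, β j := hwle
        _ ≤ 5 ^ k * ∏ j, β j := by gcongr; norm_num
    have hholder : ∑' m, |M m| * w m ≤
        CV.normL α M * (5 ^ k * ∏ j, β j) ^ ((α - 1) / α) := by
      refine (Real.inner_le_Lp_mul_Lq_tsum_of_nonneg hconj (fun m => abs_nonneg (M m)) hw0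
        (CV.summable_abs_rpow hM hα.le) hwqs).trans ?_
      rw [← hqinv]
      refine mul_le_mul_of_nonneg_left (Real.rpow_le_rpow
        (tsum_nonneg fun m => Real.rpow_nonneg (hw0 m) _) hle5 (by positivity)) ?_
      exact Real.rpow_nonneg (tsum_nonneg fun m => by positivity) _
    have hfac : (5 : ℝ) ^ (-((k : ℝ) * (α - 1) / α)) * ∏ j, (β j) ^ (-((α - 1) / α)) =
        ((5 ^ k * ∏ j, β j) ^ ((α - 1) / α))⁻¹ := by
      rw [Real.finsetProd_rpow _ _ (fun j _ => (hβ0 j).le), Real.rpow_neg hP0.le, mul_div_assoc,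
        Real.rpow_neg (by norm_num), Real.rpow_mul (by norm_num), Real.rpow_natCast,
        Real.mul_rpow (by positivity) hP0.le, mul_inv]
    rw [mul_assoc (C ^ k)⁻¹, hfac, ← mul_inv, inv_mul_le_iff₀ (by positivity)]
    calc ‖V‖ ≤ C ^ k * (CV.normL α M * (5 ^ k * ∏ j, β j) ^ ((α - 1) / α)) :=
          hV.trans (by gcongr)
      _ = _ := by ring
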